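/- arXiv:2311.08875 — 2 statements merged into one kernel-verified Lean document; each statement's English description precedes it below -/
import Mathlib

section
/- Let L ⊂ K be number fields. Then Δ(L)^{[K:L]} divides Δ(K), where Δ denotes the discriminant of the number field. -/
theorem stmt_8 (L K : Type*) [Field L] [Field K] [NumberField L] [NumberField K]
    [Algebra L K] :
    NumberField.discr L ^ Module.finrank L K ∣ NumberField.discr K := by
  rw [← Int.natAbs_dvd_natAbs, Int.natAbs_pow,
    NumberField.natAbs_discr_eq_absNorm_differentIdeal_mul_natAbs_discr_pow L (NumberField.RingOfIntegers L) K (NumberField.RingOfIntegers K)]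
  exact Dvd.intro_left _ rfl
end

section
/- The polynomial f(x) = x⁴ + 21x³ + 86x² + 21x + 1 is irreducible over ℚ and monogenic (a root generates a power basis of the ring of integers). -/
open Polynomial NumberField

theorem irr : Irreducible ((X : Polynomial ℤ) ^ 4 + 21 * X ^ 3 + 86 * X ^ 2 + 21 * X + 1) := by
  have h : Irreducible ((X : Polynomial ℤ) ^ 4 + C 25 * X ^ 3 + C 155 * X ^ 2 + C 260 * X + C 130) := by
    have hd : ((X : Polynomial ℤ) ^ 4 + C 25 * X ^ 3 + C 155 * X ^ 2 + C 260 * X + C 130).natDegree = 4 := by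
      compute_degree!
    have hm : ((X : Polynomial ℤ) ^ 4 + C 25 * X ^ 3 + C 155 * X ^ 2 + C 260 * X + C 130).Monic := by
      monicity!
    refine irreducible_of_eisenstein_criterion (P := Ideal.span {(5:ℤ)}) ?_ ?_ ?_ ?_ ?_ hm.isPrimitive
    · rw [Ideal.span_singleton_prime (by norm_num)]
      exact Int.prime_iff_natAbs_prime.2 (by norm_num)
    · rw [hm.leadingCoeff, Ideal.mem_span_singleton]; norm_num
    · intro n hn
      rw [degree_eq_natDegree hm.ne_zero, hd] at hn
      have hn : n < 4 := by exact_mod_cast hn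
      rw [Ideal.mem_span_singleton]
      interval_cases n <;> simp [coeff_X]
    · rw [degree_eq_natDegree hm.ne_zero, hd]; norm_num
    · rw [Ideal.span_singleton_pow, Ideal.mem_span_singleton]
      simp
  have e : (Polynomial.algEquivAevalXAddC (1:ℤ)) ((X : Polynomial ℤ) ^ 4 + 21 * X ^ 3 + 86 * X ^ 2 + 21 * X + 1) = (X : Polynomial ℤ) ^ 4 + C 25 * X ^ 3 + C 155 * X ^ 2 + C 260 * X + C 130 := by
    have hX : (Polynomial.algEquivAevalXAddC (1:ℤ)) X = X + 1 := by simp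
    simp only [map_add, map_mul, map_pow, map_ofNat, map_one, hX]
    ring
  rw [← e] at h
  exact (MulEquiv.irreducible_iff _).1 h

def tt (n : ℕ) : ℤ := [4, -21, 269, -3906, 59329, -915621, 14207504, -220856181, 3435303169, -53445176946, 831536415629, -12937900021221, 201302682114244].getD n 0

def Sh (a b c d : ℤ) (s : ℕ → ℤ) (n : ℕ) : ℤ := a * s n + b * s (n+1) + c * s (n+2) + d * s (n+3)

theorem Tpow {R : Type*} [CommRing R] (T : R →+ ℤ) (θ : R)
    (hθ : θ ^ 4 + 21 * θ ^ 3 + 86 * θ ^ 2 + 21 * θ + 1 = 0)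
    (h0 : T 1 = 4) (h1 : T θ = -21) (h2 : T (θ^2) = 269) (h3 : T (θ^3) = -3906) (n : ℕ) (hn : n ≤ 12) :
    T (θ ^ n) = tt n := by
  have hm : ∀ (m : ℤ) (x : R), T (m * x) = m * T x := by
    intro m x; rw [← zsmul_eq_mul, map_zsmul, smul_eq_mul]
  have hrec : ∀ n, T (θ^(n+4)) = -21 * T (θ^(n+3)) - 86 * T (θ^(n+2)) - 21 * T (θ^(n+1)) - T (θ^n) := by
    intro n
    have : θ^(n+4) + ((21:ℤ):R) * θ^(n+3) + ((86:ℤ):R) * θ^(n+2) + ((21:ℤ):R) * θ^(n+1) + θ^n = 0 := by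
      push_cast
      linear_combination θ^n * hθ
    have := congrArg T this
    simp only [map_add, hm, map_zero] at this
    linarith
  have r0 := hrec 0
  have r1 := hrec 1
  have r2 := hrec 2
  have r3 := hrec 3
  have r4 := hrec 4
  have r5 := hrec 5
  have r6 := hrec 6
  have r7 := hrec 7
  have r8 := hrec 8
  norm_num at r0 r1 r2 r3 r4 r5 r6 r7 r8
  simp only [h0, h1, h2, h3] at r0
  simp only [h1, h2, h3, r0] at r1
  simp only [h2, h3, r0, r1] at r2
  simp only [h3, r0, r1, r2] at r3
  simp only [r0, r1, r2, r3] at r4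
  simp only [r1, r2, r3, r4] at r5
  simp only [r2, r3, r4, r5] at r6
  simp only [r3, r4, r5, r6] at r7
  simp only [r4, r5, r6, r7] at r8
  interval_cases n <;> simp [tt, *]

theorem cond_dvd {R : Type*} [CommRing R] (T : R →+ ℤ) (θ : R)
    (hT : ∀ n ≤ 12, T (θ ^ n) = tt n) (p a b c d : ℤ) (α : R)
    (h : (p:R) * α = a + b * θ + c * θ^2 + d * θ^3) (k n : ℕ) (hk : 3 * k + n ≤ 12) :
    p ^ k ∣ (Sh a b c d)^[k] tt n := by
  have hm : ∀ (m : ℤ) (x : R), T (m * x) = m * T x := by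
    intro m x; rw [← zsmul_eq_mul, map_zsmul, smul_eq_mul]
  have key : ∀ k n, 3 * k + n ≤ 12 → T (((p ^ k : ℤ) : R) * (α ^ k * θ ^ n)) = (Sh a b c d)^[k] tt n := by
    intro k
    induction k with
    | zero => intro n hn; simpa using hT n (by omega)
    | succ k ih =>
      intro n hn
      rw [Function.iterate_succ_apply', Sh, ← ih n (by omega), ← ih (n+1) (by omega),
        ← ih (n+2) (by omega), ← ih (n+3) (by omega), ← hm, ← hm, ← hm, ← hm,
        ← map_add, ← map_add, ← map_add]
      congr 1
      push_cast
      linear_combination (p:R)^k * α^k * θ^n * h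
  rw [← key k n hk, hm]
  exact dvd_mul_right _ _

def Good (p a b c d : ℤ) : Prop := ∀ k n, 3 * k + n ≤ 12 → p ^ k ∣ (Sh a b c d)^[k] tt n

theorem strip {R : Type*} [CommRing R] [IsDomain R] [CharZero R] (T : R →+ ℤ) (θ : R)
    (hT : ∀ n ≤ 12, T (θ ^ n) = tt n) (p : ℤ) (hp : 0 < p)
    (H : ∀ a b c d : ℤ, 0 ≤ a → a < p → 0 ≤ b → b < p → 0 ≤ c → c < p → 0 ≤ d → d < p →
      Good p a b c d → a = 0 ∧ b = 0 ∧ c = 0 ∧ d = 0) (α : R)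
    (h : ∃ a b c d : ℤ, (p:R) * α = a + b * θ + c * θ^2 + d * θ^3) :
    ∃ a b c d : ℤ, α = a + b * θ + c * θ^2 + d * θ^3 := by
  obtain ⟨a, b, c, d, h⟩ := h
  refine ⟨a / p, b / p, c / p, d / p, ?_⟩
  have ea : ((a:ℤ):R) = ((p * (a / p) + a % p : ℤ) : R) := by rw [Int.mul_ediv_add_emod]
  have eb : ((b:ℤ):R) = ((p * (b / p) + b % p : ℤ) : R) := by rw [Int.mul_ediv_add_emod]
  have ec : ((c:ℤ):R) = ((p * (c / p) + c % p : ℤ) : R) := by rw [Int.mul_ediv_add_emod]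
  have ed : ((d:ℤ):R) = ((p * (d / p) + d % p : ℤ) : R) := by rw [Int.mul_ediv_add_emod]
  set u := (((a / p : ℤ) : R) + (b / p : ℤ) * θ + (c / p : ℤ) * θ^2 + (d / p : ℤ) * θ^3) with hu
  have h' : (p:R) * (α - u) = (a % p : ℤ) + (b % p : ℤ) * θ + (c % p : ℤ) * θ^2 + (d % p : ℤ) * θ^3 := by
    rw [mul_sub, h, ea, eb, ec, ed, hu]
    push_cast
    ring
  have m1 := fun x => Int.emod_nonneg x hp.ne'
  have m2 := fun x => Int.emod_lt_of_pos x hp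
  obtain ⟨z1, z2, z3, z4⟩ := H _ _ _ _ (m1 a) (m2 a) (m1 b) (m2 b) (m1 c) (m2 c) (m1 d) (m2 d)
    (cond_dvd T θ hT p _ _ _ _ _ h')
  rw [z1, z2, z3, z4] at h'
  have hp0 : (p:R) ≠ 0 := by exact_mod_cast hp.ne'
  have : (p:R) * (α - u) = 0 := by rw [h']; simp
  exact sub_eq_zero.1 ((mul_eq_zero.1 this).resolve_left hp0)

theorem lin {p a b c d : ℤ} (h : Good p a b c d) :
   p ∣ a*4+b*(-21)+c*269+d*(-3906) ∧ p ∣ a*(-21)+b*269+c*(-3906)+d*59329 ∧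
   p ∣ a*269+b*(-3906)+c*59329+d*(-915621) ∧ p ∣ a*(-3906)+b*59329+c*(-915621)+d*14207504 := by
  have h0 := h 1 0 (by norm_num)
  have h1 := h 1 1 (by norm_num)
  have h2 := h 1 2 (by norm_num)
  have h3 := h 1 3 (by norm_num)
  simp only [pow_one, Function.iterate_one, Sh, tt, List.getD] at h0 h1 h2 h3
  exact ⟨h0, h1, h2, h3⟩

def Good' (p a b c d : ℤ) : Prop :=
  (∀ n < 4, p ^ 2 ∣ Sh a b c d (Sh a b c d tt) n) ∧ 
  p ^ 3 ∣ Sh a b c d (Sh a b c d (Sh a b c d tt)) 0 ∧ p ^ 3 ∣ Sh a b c d (Sh a b c d (Sh a b c d tt)) 1 ∧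
  p ^ 4 ∣ Sh a b c d (Sh a b c d (Sh a b c d (Sh a b c d tt))) 0

instance (p a b c d : ℤ) : Decidable (Good' p a b c d) := by unfold Good'; infer_instance

theorem Good.good' {p a b c d : ℤ} (h : Good p a b c d) : Good' p a b c d :=
  ⟨fun n hn => h 2 n (by omega), h 3 0 (by omega), h 3 1 (by omega), h 4 0 (by omega)⟩

theorem H2 (a b c d : ℤ) (a0 : 0 ≤ a) (a1 : a < 2) (b0 : 0 ≤ b) (b1 : b < 2) (c0 : 0 ≤ c) (c1 : c < 2)
    (d0 : 0 ≤ d) (d1 : d < 2) (h : Good 2 a b c d) : a = 0 ∧ b = 0 ∧ c = 0 ∧ d = 0 := by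
  have g := h.good'
  obtain ⟨⟨x0, h0⟩, ⟨x1, h1⟩, ⟨x2, h2⟩, ⟨x3, h3⟩⟩ := lin h
  have r0 : (2:ℤ) ∣ 1*a + 1*b + 0*c + 1*d :=
    ⟨0*x0 + 1*x1 + 0*x2 + 0*x3 - (-11)*a - (134)*b - (-1953)*c - (29664)*d, by linear_combination 0*h0 + 1*h1 + 0*h2 + 0*h3⟩
  have r1 : (2:ℤ) ∣ 0*a + 1*b + 1*c + 0*d :=
    ⟨1*x0 + 0*x1 + 0*x2 + 0*x3 - (2)*a - (-11)*b - (134)*c - (-1953)*d, by linear_combination 1*h0 + 0*h1 + 0*h2 + 0*h3⟩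
  clear h0 h1 h2 h3
  have e : c = b := by omega
  have e' : d = (a + b) % 2 := by omega
  subst e e'
  clear h c0 c1 d0 d1
  interval_cases a <;> interval_cases c <;> revert g <;> decide +kernel

theorem H3 (a b c d : ℤ) (a0 : 0 ≤ a) (a1 : a < 3) (b0 : 0 ≤ b) (b1 : b < 3) (c0 : 0 ≤ c) (c1 : c < 3)
    (d0 : 0 ≤ d) (d1 : d < 3) (h : Good 3 a b c d) : a = 0 ∧ b = 0 ∧ c = 0 ∧ d = 0 := by
  have g := h.good'
  obtain ⟨⟨x0, h0⟩, ⟨x1, h1⟩, ⟨x2, h2⟩, ⟨x3, h3⟩⟩ := lin h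
  have r0 : (3:ℤ) ∣ 0*a + 2*b + 0*c + 1*d :=
    ⟨0*x0 + 1*x1 + 0*x2 + 0*x3 - (-7)*a - (89)*b - (-1302)*c - (19776)*d, by linear_combination 0*h0 + 1*h1 + 0*h2 + 0*h3⟩
  have r1 : (3:ℤ) ∣ 2*a + 0*b + 1*c + 0*d :=
    ⟨2*x0 + 0*x1 + 0*x2 + 0*x3 - (2)*a - (-14)*b - (179)*c - (-2604)*d, by linear_combination 2*h0 + 0*h1 + 0*h2 + 0*h3⟩
  clear h0 h1 h2 h3
  have e : c = a := by omega
  have e' : d = b := by omega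
  subst e e'
  clear h
  interval_cases c <;> interval_cases d <;> revert g <;> decide +kernel

theorem H7 (a b c d : ℤ) (a0 : 0 ≤ a) (a1 : a < 7) (b0 : 0 ≤ b) (b1 : b < 7) (c0 : 0 ≤ c) (c1 : c < 7)
    (d0 : 0 ≤ d) (d1 : d < 7) (h : Good 7 a b c d) : a = 0 ∧ b = 0 ∧ c = 0 ∧ d = 0 := by
  have g := h.good'
  obtain ⟨⟨x0, h0⟩, ⟨x1, h1⟩, ⟨x2, h2⟩, ⟨x3, h3⟩⟩ := lin h
  have r0 : (7:ℤ) ∣ 0*a + 6*b + 0*c + 1*d :=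
    ⟨0*x0 + 2*x1 + 0*x2 + 0*x3 - (-6)*a - (76)*b - (-1116)*c - (16951)*d, by linear_combination 0*h0 + 2*h1 + 0*h2 + 0*h3⟩
  have r1 : (7:ℤ) ∣ 6*a + 0*b + 1*c + 0*d :=
    ⟨5*x0 + 0*x1 + 0*x2 + 0*x3 - (2)*a - (-15)*b - (192)*c - (-2790)*d, by linear_combination 5*h0 + 0*h1 + 0*h2 + 0*h3⟩
  clear h0 h1 h2 h3
  have e : c = a := by omega
  have e' : d = b := by omega
  subst e e'
  clear h
  interval_cases c <;> interval_cases d <;> revert g <;> decide +kernel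

theorem H5 (a b c d : ℤ) (a0 : 0 ≤ a) (a1 : a < 5) (b0 : 0 ≤ b) (b1 : b < 5) (c0 : 0 ≤ c) (c1 : c < 5)
    (d0 : 0 ≤ d) (d1 : d < 5) (h : Good 5 a b c d) : a = 0 ∧ b = 0 ∧ c = 0 ∧ d = 0 := by
  have g := h.good'
  obtain ⟨⟨x0, h0⟩, ⟨x1, h1⟩, ⟨x2, h2⟩, ⟨x3, h3⟩⟩ := lin h
  have r0 : (5:ℤ) ∣ 1*a + 1*b + 1*c + 1*d :=
    ⟨4*x0 + 0*x1 + 0*x2 + 0*x3 - (3)*a - (-17)*b - (215)*c - (-3125)*d, by linear_combination 4*h0 + 0*h1 + 0*h2 + 0*h3⟩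
  clear h0 h1 h2 h3
  have e' : d = (-(a + b + c)) % 5 := by omega
  subst e'
  clear h d0 d1
  interval_cases a <;> interval_cases b <;> interval_cases c <;> revert g <;> decide +kernel

theorem H13 (a b c d : ℤ) (a0 : 0 ≤ a) (a1 : a < 13) (b0 : 0 ≤ b) (b1 : b < 13) (c0 : 0 ≤ c) (c1 : c < 13)
    (d0 : 0 ≤ d) (d1 : d < 13) (h : Good 13 a b c d) : a = 0 ∧ b = 0 ∧ c = 0 ∧ d = 0 := by
  have g := h.good'
  obtain ⟨⟨x0, h0⟩, ⟨x1, h1⟩, ⟨x2, h2⟩, ⟨x3, h3⟩⟩ := lin h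
  have r0 : (13:ℤ) ∣ 1*a + 0*b + 0*c + 1*d :=
    ⟨8*x0 + 0*x1 + 11*x2 + 0*x3 - (230)*a - (-3318)*b - (50367)*c - (-777160)*d, by linear_combination 8*h0 + 0*h1 + 11*h2 + 0*h3⟩
  have r1 : (13:ℤ) ∣ 9*a + 0*b + 1*c + 0*d :=
    ⟨5*x0 + 3*x1 + 0*x2 + 0*x3 - (-4)*a - (54)*b - (-798)*c - (12189)*d, by linear_combination 5*h0 + 3*h1 + 0*h2 + 0*h3⟩
  have r2 : (13:ℤ) ∣ 4*a + 1*b + 0*c + 0*d :=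
    ⟨6*x0 + 5*x1 + 8*x2 + 0*x3 - (159)*a - (-2310)*b - (35132)*c - (-542443)*d, by linear_combination 6*h0 + 5*h1 + 8*h2 + 0*h3⟩
  clear h0 h1 h2 h3
  have e1 : b = (9 * a) % 13 := by omega
  have e2 : c = (4 * a) % 13 := by omega
  have e3 : d = (12 * a) % 13 := by omega
  subst e1 e2 e3
  clear h b0 b1 c0 c1 d0 d1
  interval_cases a <;> revert g <;> decide +kernel

theorem H23 (a b c d : ℤ) (a0 : 0 ≤ a) (a1 : a < 23) (b0 : 0 ≤ b) (b1 : b < 23) (c0 : 0 ≤ c) (c1 : c < 23)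
    (d0 : 0 ≤ d) (d1 : d < 23) (h : Good 23 a b c d) : a = 0 ∧ b = 0 ∧ c = 0 ∧ d = 0 := by
  have g := h.good'
  obtain ⟨⟨x0, h0⟩, ⟨x1, h1⟩, ⟨x2, h2⟩, ⟨x3, h3⟩⟩ := lin h
  have r0 : (23:ℤ) ∣ 22*a + 0*b + 0*c + 1*d :=
    ⟨13*x0 + 4*x1 + 12*x2 + 0*x3 - (138)*a - (-2003)*b - (30427)*c - (-469605)*d, by linear_combination 13*h0 + 4*h1 + 12*h2 + 0*h3⟩
  have r1 : (23:ℤ) ∣ 3*a + 0*b + 1*c + 0*d :=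
    ⟨18*x0 + 14*x1 + 4*x2 + 0*x3 - (37)*a - (-532)*b - (8151)*c - (-126182)*d, by linear_combination 18*h0 + 14*h1 + 4*h2 + 0*h3⟩
  have r2 : (23:ℤ) ∣ 3*a + 1*b + 0*c + 0*d :=
    ⟨3*x0 + 18*x1 + 13*x2 + 0*x3 - (136)*a - (-2000)*b - (30512)*c - (-471603)*d, by linear_combination 3*h0 + 18*h1 + 13*h2 + 0*h3⟩
  clear h0 h1 h2 h3
  have e1 : b = (20 * a) % 23 := by omega
  have e2 : c = (20 * a) % 23 := by omega
  have e3 : d = (1 * a) % 23 := by omega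
  subst e1 e2 e3
  clear h b0 b1 c0 c1 d0 d1
  interval_cases a <;> revert g <;> decide +kernel

theorem trace_vals (K : Type) [Field K] [NumberField K] (x : K) (b : Module.Basis (Fin 4) ℚ K)
    (hb : ∀ i, b i = x ^ (i : ℕ)) (hx : x ^ 4 + 21 * x ^ 3 + 86 * x ^ 2 + 21 * x + 1 = 0) :
    Algebra.trace ℚ K 1 = 4 ∧ Algebra.trace ℚ K x = -21 ∧ Algebra.trace ℚ K (x ^ 2) = 269 ∧
    Algebra.trace ℚ K (x ^ 3) = -3906 := by
  have hC : Algebra.leftMulMatrix b x = !![0, 0, 0, -1; 1, 0, 0, -21; 0, 1, 0, -86; 0, 0, 1, -21] := by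
    have e0 : x * b 0 = b 1 := by simp [hb]
    have e1 : x * b 1 = b 2 := by simp [hb]; ring
    have e2 : x * b 2 = b 3 := by simp [hb]; ring
    have e3 : x * b 3 = (-1 : ℚ) • b 0 + (-21 : ℚ) • b 1 + (-86 : ℚ) • b 2 + (-21 : ℚ) • b 3 := by
      simp [hb, Algebra.smul_def]
      linear_combination hx
    ext i j
    rw [Algebra.leftMulMatrix_eq_repr_mul]
    fin_cases j <;> simp only [Fin.zero_eta, Fin.mk_one, Fin.reduceFinMk, e0, e1, e2, e3, map_add, map_smul, Module.Basis.repr_self] <;> fin_cases i <;> simp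
  refine ⟨?_, ?_, ?_, ?_⟩
  · rw [← map_one (algebraMap ℚ K), Algebra.trace_algebraMap_of_basis b]; simp
  · rw [Algebra.trace_eq_matrix_trace b, hC]; simp [Matrix.trace, Fin.sum_univ_succ]
  · rw [Algebra.trace_eq_matrix_trace b, map_pow, hC]
    norm_num [Matrix.trace, Fin.sum_univ_succ, pow_succ]
  · rw [Algebra.trace_eq_matrix_trace b, map_pow, hC]
    norm_num [Matrix.trace, Fin.sum_univ_succ, pow_succ]

theorem stmt_15 :
    Irreducible (((X : Polynomial ℤ) ^ 4 + 21 * X ^ 3 + 86 * X ^ 2 + 21 * X + 1).map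
      (Int.castRingHom ℚ)) ∧
    ∀ (K : Type) [Field K] [NumberField K] (θ : 𝓞 K),
      Polynomial.aeval (algebraMap (𝓞 K) K θ)
        ((X : Polynomial ℤ) ^ 4 + 21 * X ^ 3 + 86 * X ^ 2 + 21 * X + 1) = 0 →
      IntermediateField.adjoin ℚ {algebraMap (𝓞 K) K θ} = ⊤ →
      Algebra.adjoin ℤ {θ} = ⊤ := by
  have hm : ((X : Polynomial ℤ) ^ 4 + 21 * X ^ 3 + 86 * X ^ 2 + 21 * X + 1).Monic := by
    monicity!
  have hd : ((X : Polynomial ℤ) ^ 4 + 21 * X ^ 3 + 86 * X ^ 2 + 21 * X + 1).natDegree = 4 := by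
    compute_degree!
  have hirr : Irreducible (((X : Polynomial ℤ) ^ 4 + 21 * X ^ 3 + 86 * X ^ 2 + 21 * X + 1).map
      (Int.castRingHom ℚ)) :=
    (IsPrimitive.Int.irreducible_iff_irreducible_map_cast hm.isPrimitive).1 irr
  refine ⟨hirr, ?_⟩
  intro K _ _ θ h0 htop
  set x : K := algebraMap (𝓞 K) K θ with hxdef
  have hx : x ^ 4 + 21 * x ^ 3 + 86 * x ^ 2 + 21 * x + 1 = 0 := by
    simpa [map_ofNat] using h0
  have hmin : minpoly ℚ x = ((X : Polynomial ℤ) ^ 4 + 21 * X ^ 3 + 86 * X ^ 2 + 21 * X + 1).map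
      (Int.castRingHom ℚ) := by
    refine (minpoly.eq_of_irreducible_of_monic hirr ?_ (hm.map _)).symm
    rw [← h0]
    exact aeval_map_algebraMap ℚ x _
  have hint : IsIntegral ℚ x := Algebra.IsIntegral.isIntegral x
  have htop' : Algebra.adjoin ℚ {x} = ⊤ := by
    rw [← IntermediateField.adjoin_simple_toSubalgebra_of_isAlgebraic hint.isAlgebraic, htop]
    rfl
  let pb := PowerBasis.ofAdjoinEqTop hint htop'
  have hdim : pb.dim = 4 := by
    rw [PowerBasis.ofAdjoinEqTop_dim, hmin, hm.natDegree_map, hd]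
  let b : Module.Basis (Fin 4) ℚ K := pb.basis.reindex (finCongr hdim)
  have hb : ∀ i, b i = x ^ (i : ℕ) := by
    intro i
    simp only [b, Module.Basis.reindex_apply, PowerBasis.basis_eq_pow]
    simp [pb]
    rfl
  obtain ⟨t0, t1, t2, t3⟩ := trace_vals K x b hb hx
  let T : 𝓞 K →+ ℤ := (Algebra.trace ℤ (𝓞 K)).toAddMonoidHom
  have hTc : ∀ y : 𝓞 K, ((T y : ℤ) : ℚ) = Algebra.trace ℚ K (algebraMap (𝓞 K) K y) := fun y =>
    Algebra.coe_trace_int y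
  have hθ : θ ^ 4 + 21 * θ ^ 3 + 86 * θ ^ 2 + 21 * θ + 1 = 0 := by
    apply FaithfulSMul.algebraMap_injective (𝓞 K) K
    simpa [map_ofNat] using hx
  have s0 : T 1 = 4 := by
    have := hTc 1
    rw [map_one (algebraMap (𝓞 K) K), t0] at this; exact_mod_cast this
  have s1 : T θ = -21 := by
    have := hTc θ
    rw [t1] at this; exact_mod_cast this
  have s2 : T (θ^2) = 269 := by
    have := hTc (θ^2)
    rw [map_pow (algebraMap (𝓞 K) K), t2] at this; exact_mod_cast this
  have s3 : T (θ^3) = -3906 := by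
    have := hTc (θ^3)
    rw [map_pow (algebraMap (𝓞 K) K), t3] at this; exact_mod_cast this
  have hT := Tpow T θ hθ s0 s1 s2 s3
  rw [eq_top_iff]
  intro α _
  have base : ∃ a b c d : ℤ, ((62790:ℤ):𝓞 K) * α = a + b * θ + c * θ^2 + d * θ^3 := by
    obtain ⟨q, hq⟩ : ∃ q : Fin 4 → ℚ, algebraMap (𝓞 K) K α = q 0 • 1 + q 1 • x + q 2 • x^2 + q 3 • x^3 := by
      refine ⟨fun i => b.repr (algebraMap (𝓞 K) K α) i, ?_⟩
      conv_lhs => rw [← b.sum_repr (algebraMap (𝓞 K) K α)]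
      simp [Fin.sum_univ_four, hb]
    have tr : ∀ n ≤ 12, Algebra.trace ℚ K (x ^ n) = (tt n : ℚ) := by
      intro n hn
      rw [← hT n hn, hTc, map_pow (algebraMap (𝓞 K) K)]
    have w : ∀ j ≤ 3, ((T (α * θ ^ j) : ℤ) : ℚ) =
        q 0 * tt j + q 1 * tt (j+1) + q 2 * tt (j+2) + q 3 * tt (j+3) := by
      intro j hj
      have : (algebraMap (𝓞 K) K (α * θ ^ j)) = q 0 • x^j + q 1 • x^(j+1) + q 2 • x^(j+2) + q 3 • x^(j+3) := by
        rw [map_mul, map_pow, hq, ← hxdef]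
        simp only [Algebra.smul_def]
        ring
      rw [hTc, this]
      simp only [map_add, map_smul, smul_eq_mul]
      rw [tr _ (by omega), tr _ (by omega), tr _ (by omega), tr _ (by omega)]
    have w0 := w 0 (by omega)
    have w1 := w 1 (by omega)
    have w2 := w 2 (by omega)
    have w3 := w 3 (by omega)
    norm_num [tt] at w0 w1 w2 w3
    generalize T α = y0 at w0
    generalize T (α * θ) = y1 at w1
    generalize T (α * θ ^ 2) = y2 at w2
    generalize T (α * θ ^ 3) = y3 at w3
    refine ⟨163307*y0 + 1068375*y1 + 265997*y2 + 12726*y3, 1068375*y0 + 8657470*y1 + 2169216*y2 + 103939*y3,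
      265997*y0 + 2169216*y1 + 543806*y2 + 26061*y3, 12726*y0 + 103939*y1 + 26061*y2 + 1249*y3, ?_⟩
    have c0 : (62790:ℚ) * q 0 = ((163307*y0 + 1068375*y1 + 265997*y2 + 12726*y3 : ℤ) : ℚ) := by
      push_cast; rw [w0, w1, w2, w3]; ring
    have c1 : (62790:ℚ) * q 1 = ((1068375*y0 + 8657470*y1 + 2169216*y2 + 103939*y3 : ℤ) : ℚ) := by
      push_cast; rw [w0, w1, w2, w3]; ring
    have c2 : (62790:ℚ) * q 2 = ((265997*y0 + 2169216*y1 + 543806*y2 + 26061*y3 : ℤ) : ℚ) := by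
      push_cast; rw [w0, w1, w2, w3]; ring
    have c3 : (62790:ℚ) * q 3 = ((12726*y0 + 103939*y1 + 26061*y2 + 1249*y3 : ℤ) : ℚ) := by
      push_cast; rw [w0, w1, w2, w3]; ring
    apply FaithfulSMul.algebraMap_injective (𝓞 K) K
    have cast : ∀ (u : ℚ) (z : ℤ), (62790:ℚ) * u = (z : ℚ) → (62790 : K) * algebraMap ℚ K u = (z : K) := by
      intro u z h
      have := congrArg (algebraMap ℚ K) h
      simpa using this
    simp only [map_add, map_mul, map_pow, map_intCast, ← hxdef]
    rw [hq, ← cast _ _ c0, ← cast _ _ c1, ← cast _ _ c2, ← cast _ _ c3]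
    simp only [Algebra.smul_def]
    push_cast
    ring
  have red : ∀ (p m : ℤ), 0 < p → (∀ a b c d : ℤ, 0 ≤ a → a < p → 0 ≤ b → b < p → 0 ≤ c → c < p → 0 ≤ d → d < p →
      Good p a b c d → a = 0 ∧ b = 0 ∧ c = 0 ∧ d = 0) →
      (∃ a b c d : ℤ, ((p * m : ℤ):𝓞 K) * α = a + b * θ + c * θ^2 + d * θ^3) →
      ∃ a b c d : ℤ, ((m : ℤ):𝓞 K) * α = a + b * θ + c * θ^2 + d * θ^3 := by
    intro p m hp H h
    apply strip T θ hT p hp H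
    simpa [mul_assoc] using h
  have f1 := red 23 2730 (by norm_num) H23 (by norm_num at base ⊢; exact base)
  have f2 := red 13 210 (by norm_num) H13 (by norm_num at f1 ⊢; exact f1)
  have f3 := red 7 30 (by norm_num) H7 (by norm_num at f2 ⊢; exact f2)
  have f4 := red 5 6 (by norm_num) H5 (by norm_num at f3 ⊢; exact f3)
  have f5 := red 3 2 (by norm_num) H3 (by norm_num at f4 ⊢; exact f4)
  have f6 := red 2 1 (by norm_num) H2 (by norm_num at f5 ⊢; exact f5)
  obtain ⟨a, b, c, d, h⟩ := f6
  have hα : α = a + b * θ + c * θ^2 + d * θ^3 := by simpa using h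
  have hmem : θ ∈ Algebra.adjoin ℤ {θ} := Algebra.self_mem_adjoin_singleton ℤ θ
  rw [hα]
  exact add_mem (add_mem (add_mem (intCast_mem _ _) (mul_mem (intCast_mem _ _) hmem))
    (mul_mem (intCast_mem _ _) (pow_mem hmem 2))) (mul_mem (intCast_mem _ _) (pow_mem hmem 3))
end
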